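/- Let E be an invertible real 3×3 matrix, p̊₁, …, p̊ₙ ∈ ℝ³ nonzero, and k₁, …, kₙ > 0. Set eᵢ := E p̊ᵢ/‖E p̊ᵢ‖ and Δ := −Σᵢ kᵢ (I − eᵢeᵢᵀ) p̊ᵢ eᵢᵀ. If trace(−Δ·(E⁻¹)ᵀ) = 0, then for every i there exists λᵢ ∈ ℝ such that E p̊ᵢ = λᵢ p̊ᵢ, i.e. every p̊ᵢ is an eigenvector of E. -/

import Mathlib

open Matrix

/-- The Euclidean norm on `ℝ³` (realized as `Fin 3 → ℝ`). -/
noncomputable def eNorm3 (x : Fin 3 → ℝ) : ℝ := Real.sqrt (x ⬝ᵥ x)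

/-- Normalization `x ↦ x/‖x‖`. -/
noncomputable def unitize (x : Fin 3 → ℝ) : Fin 3 → ℝ := (eNorm3 x)⁻¹ • x

lemma eNorm3_pos {x : Fin 3 → ℝ} (hx : x ≠ 0) : 0 < eNorm3 x :=
  Real.sqrt_pos.2 (lt_of_le_of_ne
    (Finset.sum_nonneg fun i _ => mul_self_nonneg (x i))
    fun h => hx (dotProduct_self_eq_zero.1 h.symm))

lemma eNorm3_mul_self (x : Fin 3 → ℝ) : eNorm3 x * eNorm3 x = x ⬝ᵥ x :=
  Real.mul_self_sqrt (Finset.sum_nonneg fun i _ => mul_self_nonneg (x i))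

lemma unitize_dotProduct_self {x : Fin 3 → ℝ} (hx : x ≠ 0) :
    unitize x ⬝ᵥ unitize x = 1 := by
  have h := (eNorm3_pos hx).ne'
  rw [unitize, smul_dotProduct, dotProduct_smul, ← eNorm3_mul_self, smul_eq_mul, smul_eq_mul]
  field_simp

lemma eNorm3_smul_unitize {x : Fin 3 → ℝ} (hx : x ≠ 0) : eNorm3 x • unitize x = x :=
  smul_inv_smul₀ (ne_of_gt (eNorm3_pos hx)) x

/-- The matrix `I - u uᵀ` acts by subtracting the component along `u`. -/
lemma one_sub_vecMulVec_self_mulVec (u p : Fin 3 → ℝ) :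
    (1 - vecMulVec u u).mulVec p = p - (u ⬝ᵥ p) • u := by
  rw [sub_mulVec, one_mulVec, vecMulVec_mulVec]
  simp

/-- For a unit vector `u`, the matrix `I - u uᵀ` is an orthogonal projection. -/
lemma one_sub_vecMulVec_self_mulVec_dotProduct {u : Fin 3 → ℝ} (hu : u ⬝ᵥ u = 1)
    (p : Fin 3 → ℝ) :
    (1 - vecMulVec u u).mulVec p ⬝ᵥ p =
      (1 - vecMulVec u u).mulVec p ⬝ᵥ (1 - vecMulVec u u).mulVec p := by
  simp only [one_sub_vecMulVec_self_mulVec, sub_dotProduct, dotProduct_sub, smul_dotProduct,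
    dotProduct_smul, hu, smul_eq_mul, dotProduct_comm p u]
  ring

lemma inv_mulVec_unitize_mulVec {E : Matrix (Fin 3) (Fin 3) ℝ} (hE : IsUnit E.det)
    (p : Fin 3 → ℝ) :
    E⁻¹.mulVec (unitize (E.mulVec p)) = (eNorm3 (E.mulVec p))⁻¹ • p := by
  rw [unitize, mulVec_smul, mulVec_mulVec, nonsing_inv_mul E hE, one_mulVec]

lemma trace_vecMulVec_mul_transpose (v w : Fin 3 → ℝ) (A : Matrix (Fin 3) (Fin 3) ℝ) :
    (vecMulVec v w * Aᵀ).trace = v ⬝ᵥ A.mulVec w := by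
  rw [vecMulVec_mul, trace_vecMulVec, vecMul_transpose]

/-- with `eᵢ = E p̊ᵢ/‖E p̊ᵢ‖`, positive gains `kᵢ` and
`Δ = −∑ᵢ kᵢ (I − eᵢeᵢᵀ) p̊ᵢ eᵢᵀ`, if `trace(−Δ (E⁻¹)ᵀ) = 0` then every `p̊ᵢ` is an
eigenvector of `E`. -/
theorem stmt_13 (n : ℕ) (E : Matrix (Fin 3) (Fin 3) ℝ) (hE : IsUnit E.det)
    (pr : Fin n → Fin 3 → ℝ) (hpr : ∀ i, pr i ≠ 0)
    (k : Fin n → ℝ) (hk : ∀ i, 0 < k i)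
    (e : Fin n → Fin 3 → ℝ) (he : ∀ i, e i = unitize (E.mulVec (pr i)))
    (Δ : Matrix (Fin 3) (Fin 3) ℝ)
    (hΔ : Δ = -∑ i, k i • vecMulVec ((1 - vecMulVec (e i) (e i)).mulVec (pr i)) (e i))
    (htr : (-Δ * E⁻¹ᵀ).trace = 0) :
    ∀ i, ∃ lam : ℝ, E.mulVec (pr i) = lam • pr i := by
  have hne : ∀ i, E.mulVec (pr i) ≠ 0 := fun i h =>
    hpr i (mulVec_injective_of_isUnit ((isUnit_iff_isUnit_det E).2 hE) (by simpa using h))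
  have hunit : ∀ i, e i ⬝ᵥ e i = 1 := fun i => by
    rw [he i]; exact unitize_dotProduct_self (hne i)
  set v : Fin n → Fin 3 → ℝ := fun i => (1 - vecMulVec (e i) (e i)).mulVec (pr i) with hv
  have hsum : ∑ i, k i * ((eNorm3 (E.mulVec (pr i)))⁻¹ * (v i ⬝ᵥ v i)) = 0 := by
    rw [← htr, hΔ, neg_neg, Finset.sum_mul, trace_sum]
    refine Finset.sum_congr rfl fun i _ => ?_
    have hinv : E⁻¹.mulVec (e i) = (eNorm3 (E.mulVec (pr i)))⁻¹ • pr i := by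
      rw [he i]; exact inv_mulVec_unitize_mulVec hE (pr i)
    rw [smul_mul, trace_smul, trace_vecMulVec_mul_transpose, hinv, dotProduct_smul,
      one_sub_vecMulVec_self_mulVec_dotProduct (hunit i), smul_eq_mul, smul_eq_mul]
  have hnonneg : ∀ i ∈ Finset.univ,
      0 ≤ k i * ((eNorm3 (E.mulVec (pr i)))⁻¹ * (v i ⬝ᵥ v i)) := fun i _ =>
    mul_nonneg (hk i).le (mul_nonneg (inv_nonneg.2 (eNorm3_pos (hne i)).le)
      (Finset.sum_nonneg fun j _ => mul_self_nonneg (v i j)))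
  intro i
  have hzero := (Finset.sum_eq_zero_iff_of_nonneg hnonneg).1 hsum i (Finset.mem_univ i)
  have hvi : v i = 0 := dotProduct_self_eq_zero.1 <|
    ((mul_eq_zero.1 hzero).resolve_left (hk i).ne' |> mul_eq_zero.1).resolve_left
      (inv_pos.2 (eNorm3_pos (hne i))).ne'
  have hp : pr i = (e i ⬝ᵥ pr i) • e i := by
    rw [← sub_eq_zero, ← one_sub_vecMulVec_self_mulVec]
    exact hvi
  have hc : e i ⬝ᵥ pr i ≠ 0 := fun h => hpr i (by rw [hp, h, zero_smul])
  have hei : e i = (e i ⬝ᵥ pr i)⁻¹ • pr i := (eq_inv_smul_iff₀ hc).2 hp.symm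
  refine ⟨eNorm3 (E.mulVec (pr i)) * (e i ⬝ᵥ pr i)⁻¹, ?_⟩
  rw [mul_smul, ← hei, he i, eNorm3_smul_unitize (hne i)]
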